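/- There exist nonempty regular closed subsets a, b, c, u, v, w of ℝ³ with EC(x,y) for every x ∈ {a,b,c} and y ∈ {u,v,w}, and with DC(a,b), DC(a,c), DC(b,c), DC(u,v), DC(u,w), DC(v,w); but there do not exist nonempty convex regular closed subsets a, b, c, u, v, w of ℝ² satisfying these same relations. (There is a consistent atomic RCC8 network over {EC, DC} with no convex solution in ℝ².) -/

import Mathlib

/-- A set is regular closed if it equals the closure of its interior. -/
def RegClosed {α : Type*} [TopologicalSpace α] (X : Set α) : Prop :=
  closure (interior X) = X

/-- RCC8: disconnected. -/
def DC {α : Type*} (a b : Set α) : Prop := a ∩ b = ∅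

/-- RCC8: externally connected. -/
def EC {α : Type*} [TopologicalSpace α] (a b : Set α) : Prop :=
  (a ∩ b).Nonempty ∧ interior a ∩ interior b = ∅

/-- RCC8: partially overlaps. -/
def PO {α : Type*} [TopologicalSpace α] (a b : Set α) : Prop :=
  (interior a ∩ interior b).Nonempty ∧ ¬ a ⊆ b ∧ ¬ b ⊆ a

/-- RCC8: tangential proper part. -/
def TPP {α : Type*} [TopologicalSpace α] (a b : Set α) : Prop :=
  a ⊂ b ∧ ¬ a ⊆ interior b

/-- RCC8: non-tangential proper part. -/
def NTPP {α : Type*} [TopologicalSpace α] (a b : Set α) : Prop :=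
  a ⊆ interior b ∧ a ≠ b

/-- RCC5: discrete from. -/
def DR {α : Type*} [TopologicalSpace α] (a b : Set α) : Prop :=
  interior a ∩ interior b = ∅

/-- RCC5: proper part. -/
def PP {α : Type*} (a b : Set α) : Prop := a ⊂ b

/-- The vertical half-slab `{x | l ≤ x k ≤ l + 1, 0 ≤ s * x 2}` in `ℝ³`. -/
def halfSlab (k : Fin 3) (l s : ℝ) : Set (EuclideanSpace ℝ (Fin 3)) :=
  {x | l ≤ x k ∧ x k ≤ l + 1 ∧ 0 ≤ s * x 2}

lemma convex_halfSlab (k : Fin 3) (l s : ℝ) : Convex ℝ (halfSlab k l s) := by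
  rintro x ⟨hx₁, hx₂, hx₃⟩ y ⟨hy₁, hy₂, hy₃⟩ t r ht hr htr
  obtain rfl : r = 1 - t := by linarith
  refine ⟨?_, ?_, ?_⟩ <;> simp only [PiLp.add_apply, PiLp.smul_apply, smul_eq_mul] <;>
    nlinarith [mul_nonneg ht hx₃, mul_nonneg hr hy₃, mul_le_mul_of_nonneg_left hx₁ ht,
      mul_le_mul_of_nonneg_left hy₁ hr, mul_le_mul_of_nonneg_left hx₂ ht,
      mul_le_mul_of_nonneg_left hy₂ hr]

lemma isClosed_halfSlab (k : Fin 3) (l s : ℝ) : IsClosed (halfSlab k l s) := by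
  have h₁ : Continuous fun x : EuclideanSpace ℝ (Fin 3) => x k := by fun_prop
  have h₂ : Continuous fun x : EuclideanSpace ℝ (Fin 3) => s * x 2 := by fun_prop
  exact (isClosed_le continuous_const h₁).inter
    ((isClosed_le h₁ continuous_const).inter (isClosed_le continuous_const h₂))

lemma interior_halfSlab_nonempty {k : Fin 3} (hk : k ≠ 2) (l : ℝ) {s : ℝ} (hs : s ≠ 0) :
    (interior (halfSlab k l s)).Nonempty := by
  have h₁ : Continuous fun x : EuclideanSpace ℝ (Fin 3) => x k := by fun_prop
  have h₂ : Continuous fun x : EuclideanSpace ℝ (Fin 3) => s * x 2 := by fun_prop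
  have hopen : IsOpen {x : EuclideanSpace ℝ (Fin 3) | l < x k ∧ x k < l + 1 ∧ 0 < s * x 2} :=
    (isOpen_lt continuous_const h₁).inter
      ((isOpen_lt h₁ continuous_const).inter (isOpen_lt continuous_const h₂))
  refine ⟨WithLp.toLp 2 fun i => if i = k then l + 1 / 2 else s,
    interior_maximal ?_ hopen ?_⟩
  · exact fun x hx => ⟨hx.1.le, hx.2.1.le, hx.2.2.le⟩
  refine ⟨?_, ?_, ?_⟩
  · simp
  · simp; norm_num
  · simpa [hk.symm] using hs

lemma regClosed_halfSlab {k : Fin 3} (hk : k ≠ 2) (l : ℝ) {s : ℝ} (hs : s ≠ 0) :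
    RegClosed (halfSlab k l s) := by
  rw [RegClosed, (convex_halfSlab k l s).closure_interior_eq_closure_of_nonempty_interior
    (interior_halfSlab_nonempty hk l hs), (isClosed_halfSlab k l s).closure_eq]

lemma halfSlab_nonempty {k : Fin 3} (hk : k ≠ 2) (l : ℝ) {s : ℝ} (hs : s ≠ 0) :
    (halfSlab k l s).Nonempty :=
  (interior_halfSlab_nonempty hk l hs).mono interior_subset

lemma dc_halfSlab (k : Fin 3) {l l' : ℝ} (h : l + 1 < l') (s : ℝ) :
    DC (halfSlab k l s) (halfSlab k l' s) := by
  rw [DC, Set.eq_empty_iff_forall_notMem]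
  rintro x ⟨⟨-, h₁, -⟩, h₂, -, -⟩
  linarith

lemma ec_halfSlab (l l' : ℝ) : EC (halfSlab 0 l (-1)) (halfSlab 1 l' 1) := by
  refine ⟨⟨!₂[l, l', 0], ?_⟩, ?_⟩
  · simp [halfSlab]
  · have hopen : IsOpenMap (EuclideanSpace.proj 2 : EuclideanSpace ℝ (Fin 3) →L[ℝ] ℝ) :=
      ContinuousLinearMap.isOpenMap _ fun r => ⟨!₂[0, 0, r], by simp⟩
    have hsub : halfSlab 0 l (-1) ∩ halfSlab 1 l' 1 ⊆
        (EuclideanSpace.proj 2 : EuclideanSpace ℝ (Fin 3) →L[ℝ] ℝ) ⁻¹' {0} := by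
      rintro x ⟨⟨-, -, h₁⟩, -, -, h₂⟩
      change x 2 = 0
      linarith
    rw [← interior_inter, ← Set.subset_empty_iff]
    refine (interior_mono hsub).trans ?_
    rw [← hopen.preimage_interior_eq_interior_preimage (by fun_prop), interior_singleton,
      Set.preimage_empty]

open Complex in
lemma div_mem_slitPlane_of_notMem_segment {a b v : ℂ} (h : v ∉ segment ℝ a b) :
    (b - v) / (a - v) ∈ slitPlane := by
  have ha : a - v ≠ 0 := fun h0 => h (sub_eq_zero.1 h0 ▸ left_mem_segment ℝ a b)
  by_contra hs
  rw [mem_slitPlane_iff, not_or, not_lt, not_not] at hs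
  obtain ⟨hre, him⟩ := hs
  obtain ⟨c, hc⟩ : ∃ c : ℝ, c = -((b - v) / (a - v)).re := ⟨_, rfl⟩
  have hc0 : 0 ≤ c := by linarith
  have hdiv : (b - v) / (a - v) = -(c : ℂ) := by
    apply Complex.ext <;> simp [hc, him]
  rw [div_eq_iff ha] at hdiv
  have hc1 : (1 + c : ℂ) ≠ 0 := by exact_mod_cast (by linarith : (1 + c : ℝ) ≠ 0)
  refine h ⟨c / (1 + c), 1 / (1 + c), by positivity, by positivity, by field_simp; ring, ?_⟩
  simp only [real_smul]
  push_cast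
  field_simp
  linear_combination hdiv

/-- The signed angle under which the segment from `a` to `b` is seen from `v`. -/
noncomputable def viewAngle (a b v : ℂ) : ℝ := ((b - v) / (a - v)).arg

lemma coe_viewAngle {a b v : ℂ} (ha : a ≠ v) (hb : b ≠ v) :
    (viewAngle a b v : Real.Angle) = (b - v).arg - (a - v).arg :=
  Complex.arg_div_coe_angle (sub_ne_zero.2 hb) (sub_ne_zero.2 ha)

lemma eq_zero_of_continuousOn_of_coe_angle_eq_zero {g : ℝ → ℝ}
    (hg : ContinuousOn g (Set.Icc 0 1)) (hcoe : ∀ t ∈ Set.Icc (0 : ℝ) 1, (g t : Real.Angle) = 0)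
    (h0 : g 0 = 0) : g 1 = 0 := by
  by_contra h1
  obtain ⟨n, hn⟩ := Real.Angle.coe_eq_zero_iff.1 (hcoe 1 (by simp))
  have hn0 : n ≠ 0 := by
    rintro rfl
    exact h1 (by simpa using hn.symm)
  have habs : Real.pi ≤ |g 1| := by
    have : (1 : ℝ) ≤ |(n : ℝ)| := by exact_mod_cast Int.one_le_abs hn0
    rw [← hn, zsmul_eq_mul, abs_mul, abs_of_pos Real.two_pi_pos]
    nlinarith [Real.pi_pos]
  obtain ⟨t, ht, hgt⟩ := intermediate_value_Icc zero_le_one hg.abs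
    (show Real.pi ∈ Set.Icc |g 0| |g 1| from ⟨by simp [h0, Real.pi_pos.le], habs⟩)
  have := hcoe t ht
  rcases eq_or_eq_neg_of_abs_eq hgt with h | h <;> rw [h] at this
  · exact Real.Angle.pi_ne_zero this
  · exact Real.Angle.pi_ne_zero (by simpa using this)

lemma viewAngle_sub_viewAngle_of_disjoint {a b c d : ℂ}
    (h : Disjoint (segment ℝ a b) (segment ℝ c d)) :
    viewAngle a b d - viewAngle a b c = viewAngle c d b - viewAngle c d a := by
  obtain ⟨m, hm⟩ : ∃ m : ℝ → ℂ, m = AffineMap.lineMap c d := ⟨_, rfl⟩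
  have hm0 : m 0 = c := by simp [hm]
  have hm1 : m 1 = d := by simp [hm]
  have hmc : Continuous m := by rw [hm]; exact AffineMap.lineMap_continuous
  have hmem : ∀ t ∈ Set.Icc (0 : ℝ) 1, m t ∈ segment ℝ c d := fun t ht => by
    rw [segment_eq_image_lineMap, hm]
    exact ⟨t, ht, rfl⟩
  have hsub : ∀ t ∈ Set.Icc (0 : ℝ) 1, segment ℝ c (m t) ⊆ segment ℝ c d := fun t ht =>
    (convex_segment c d).segment_subset (left_mem_segment ℝ c d) (hmem t ht)
  have hne : ∀ {z w}, z ∈ segment ℝ a b → w ∈ segment ℝ c d → z ≠ w := fun hz hw =>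
    h.ne_of_mem hz hw
  have ha := left_mem_segment ℝ a b
  have hb := right_mem_segment ℝ a b
  have hc := left_mem_segment ℝ c d
  have hcont : ∀ {f : ℝ → ℂ}, ContinuousOn f (Set.Icc 0 1) →
      (∀ t ∈ Set.Icc (0 : ℝ) 1, f t ∈ Complex.slitPlane) →
      ContinuousOn (fun t => (f t).arg) (Set.Icc 0 1) := fun hf hs t ht =>
    (Complex.continuousAt_arg (hs t ht)).comp_continuousWithinAt (hf t ht)
  have key := eq_zero_of_continuousOn_of_coe_angle_eq_zero
    (g := fun t => viewAngle a b (m t) - viewAngle a b c - viewAngle c (m t) b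
      + viewAngle c (m t) a) ?_ ?_ ?_
  · simp only [hm1] at key
    linarith
  · refine ((ContinuousOn.sub ?_ continuousOn_const).sub ?_).add ?_
    · refine hcont (ContinuousOn.div (by fun_prop) (by fun_prop) fun t ht => ?_) fun t ht => ?_
      · exact sub_ne_zero.2 (hne ha (hmem t ht))
      · exact div_mem_slitPlane_of_notMem_segment fun hh => hne hh (hmem t ht) rfl
    · refine hcont (by fun_prop) fun t ht => ?_
      exact div_mem_slitPlane_of_notMem_segment fun hh => hne hb (hsub t ht hh) rfl
    · refine hcont (by fun_prop) fun t ht => ?_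
      exact div_mem_slitPlane_of_notMem_segment fun hh => hne ha (hsub t ht hh) rfl
  · intro t ht
    have hmt := hmem t ht
    have hflip : ∀ {z w}, z ∈ segment ℝ a b → w ∈ segment ℝ c d →
        ((w - z).arg : Real.Angle) = (z - w).arg + Real.pi := fun {z w} hz hw => by
      rw [← neg_sub, Complex.arg_neg_coe_angle (sub_ne_zero.2 (hne hz hw))]
    simp only [Real.Angle.coe_add, Real.Angle.coe_sub]
    rw [coe_viewAngle (hne ha hmt) (hne hb hmt), coe_viewAngle (hne ha hc) (hne hb hc),
      coe_viewAngle (hne hb hc).symm (hne hb hmt).symm,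
      coe_viewAngle (hne ha hc).symm (hne ha hmt).symm,
      hflip hb hmt, hflip hb hc, hflip ha hmt, hflip ha hc]
    abel
  · have hself : ∀ {z w : ℂ}, z ≠ w → viewAngle z z w = 0 := fun hzw => by
      simp [viewAngle, div_self (sub_ne_zero.2 hzw)]
    simp [hm0, hself (hne ha hc).symm, hself (hne hb hc).symm]

/-- `K₃,₃` has no planar drawing in which every edge is a path of two segments. -/
lemma false_of_disjoint_two_segment_paths (x y : Fin 3 → ℂ) (p : Fin 3 → Fin 3 → ℂ)
    (h : ∀ i j k l, i ≠ k → j ≠ l → Disjoint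
      (segment ℝ (x i) (p i j) ∪ segment ℝ (p i j) (y j))
      (segment ℝ (x k) (p k l) ∪ segment ℝ (p k l) (y l))) : False := by
  obtain ⟨D, hD⟩ : ∃ D : Fin 3 → Fin 3 → ℂ → ℝ, ∀ i j v, D i j v =
      viewAngle (x i) (p i j) v + viewAngle (p i j) (y j) v := ⟨_, fun _ _ _ => rfl⟩
  have hsquare : ∀ i j k l, i ≠ k → j ≠ l →
      D i j (y l) - D i j (x k) = D k l (y j) - D k l (x i) := by
    intro i j k l hik hjl
    have hdisj := h i j k l hik hjl
    simp only [Set.disjoint_union_left, Set.disjoint_union_right] at hdisj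
    obtain ⟨⟨h₁, h₂⟩, h₃, h₄⟩ := hdisj
    have e₁ := viewAngle_sub_viewAngle_of_disjoint h₁
    have e₂ := viewAngle_sub_viewAngle_of_disjoint h₂
    have e₃ := viewAngle_sub_viewAngle_of_disjoint h₃
    have e₄ := viewAngle_sub_viewAngle_of_disjoint h₄
    simp only [hD]
    linarith
  have hne : ∀ i j k, i ≠ k → x i ≠ x k ∧ p i j ≠ x k ∧ y j ≠ x k := by
    intro i j k hik
    obtain ⟨l, hjl⟩ : ∃ l, j ≠ l := ⟨j + 1, by fin_cases j <;> decide⟩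
    have hxk : x k ∈ segment ℝ (x k) (p k l) ∪ segment ℝ (p k l) (y l) :=
      Or.inl (left_mem_segment ℝ _ _)
    have hd := h i j k l hik hjl
    exact ⟨hd.ne_of_mem (Or.inl (left_mem_segment ℝ _ _)) hxk,
      hd.ne_of_mem (Or.inl (right_mem_segment ℝ _ _)) hxk,
      hd.ne_of_mem (Or.inr (right_mem_segment ℝ _ _)) hxk⟩
  have hcoe : ∀ i j k, i ≠ k →
      (D i j (x k) : Real.Angle) = (y j - x k).arg - (x i - x k).arg := by
    intro i j k hik
    obtain ⟨hx, hp, hy⟩ := hne i j k hik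
    rw [hD, Real.Angle.coe_add, coe_viewAngle hx hp, coe_viewAngle hp hy]
    abel
  have hflip : ∀ i k, i ≠ k →
      ((x i - x k).arg : Real.Angle) = (x k - x i).arg + Real.pi := by
    intro i k hik
    rw [← neg_sub, Complex.arg_neg_coe_angle (sub_ne_zero.2 (hne k 0 i hik.symm).1)]
  have hsum : ∑ j, (D 0 j (x 1) - D 0 j (x 2) + (D 1 j (x 2) - D 1 j (x 0))
      + (D 2 j (x 0) - D 2 j (x 1))) = 0 := by
    have hcycle : ∀ j l, j ≠ l →
        (D 0 j (y l) - D 0 j (x 1) - D 1 l (y j) + D 1 l (x 0))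
        + (D 1 j (y l) - D 1 j (x 2) - D 2 l (y j) + D 2 l (x 1))
        + (D 2 j (y l) - D 2 j (x 0) - D 0 l (y j) + D 0 l (x 2)) = 0 := by
      intro j l hjl
      linarith [hsquare 0 j 1 l (by decide) hjl, hsquare 1 j 2 l (by decide) hjl,
        hsquare 2 j 0 l (by decide) hjl]
    simp only [Fin.sum_univ_three]
    linarith [hcycle 0 1 (by decide), hcycle 0 2 (by decide), hcycle 1 0 (by decide),
      hcycle 1 2 (by decide), hcycle 2 0 (by decide), hcycle 2 1 (by decide)]
  have hangle : ∀ j, ((D 0 j (x 1) - D 0 j (x 2) + (D 1 j (x 2) - D 1 j (x 0))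
      + (D 2 j (x 0) - D 2 j (x 1)) : ℝ) : Real.Angle) = Real.pi := by
    intro j
    simp only [Real.Angle.coe_add, Real.Angle.coe_sub]
    rw [hcoe 0 j 1 (by decide), hcoe 0 j 2 (by decide), hcoe 1 j 2 (by decide),
      hcoe 1 j 0 (by decide), hcoe 2 j 0 (by decide), hcoe 2 j 1 (by decide),
      hflip 1 0 (by decide), hflip 2 1 (by decide), hflip 0 2 (by decide)]
    have htwo : (Real.pi : Real.Angle) + Real.pi = 0 := Real.Angle.coe_pi_add_coe_pi
    calc
      _ = (Real.pi + Real.pi + Real.pi : Real.Angle) := by abel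
      _ = Real.pi := by rw [htwo, zero_add]
  have hpi : (Real.pi + Real.pi + Real.pi : Real.Angle) = 0 := by
    rw [← Real.Angle.coe_zero, ← hsum, Fin.sum_univ_three, Real.Angle.coe_add, Real.Angle.coe_add,
      hangle, hangle, hangle]
  rw [Real.Angle.coe_pi_add_coe_pi, zero_add] at hpi
  exact Real.Angle.pi_ne_zero hpi

lemma RegClosed.disjoint_interior_left {α : Type*} [TopologicalSpace α] {a u : Set α}
    (hu : RegClosed u) (h : EC a u) : Disjoint (interior a) u := by
  have := (Set.disjoint_iff_inter_eq_empty.2 h.2).closure_right isOpen_interior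
  rwa [hu] at this

lemma EC.symm {α : Type*} [TopologicalSpace α] {a b : Set α} (h : EC a b) : EC b a :=
  ⟨Set.inter_comm a b ▸ h.1, Set.inter_comm (interior a) _ ▸ h.2⟩

lemma RegClosed.interior_nonempty {α : Type*} [TopologicalSpace α] {a : Set α}
    (ha : RegClosed a) (h : a.Nonempty) : (interior a).Nonempty := by
  rwa [← closure_nonempty_iff, ha]

lemma Convex.eq_right_of_mem_segment_of_notMem_interior {E : Type*} [AddCommGroup E] [Module ℝ E]
    [TopologicalSpace E] [IsTopologicalAddGroup E] [ContinuousSMul ℝ E] {s : Set E}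
    (hs : Convex ℝ s) {x p z : E} (hx : x ∈ interior s) (hp : p ∈ s) (hz : z ∈ segment ℝ x p)
    (hzs : z ∉ interior s) : z = p := by
  rw [← insert_endpoints_openSegment] at hz
  rcases hz with rfl | rfl | hz
  · exact absurd hx hzs
  · rfl
  · exact absurd (hs.openSegment_interior_self_subset_interior hx hp hz) hzs

lemma false_of_convex_regClosed_contacts (a u : Fin 3 → Set (EuclideanSpace ℝ (Fin 2)))
    (hane : ∀ i, (a i).Nonempty) (hune : ∀ j, (u j).Nonempty)
    (hac : ∀ i, Convex ℝ (a i)) (huc : ∀ j, Convex ℝ (u j))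
    (har : ∀ i, RegClosed (a i)) (hur : ∀ j, RegClosed (u j))
    (hec : ∀ i j, EC (a i) (u j))
    (had : Pairwise fun i k => Disjoint (a i) (a k))
    (hud : Pairwise fun j l => Disjoint (u j) (u l)) : False := by
  choose x hx using fun i => (har i).interior_nonempty (hane i)
  choose y hy using fun j => (hur j).interior_nonempty (hune j)
  choose p hp using fun i j => (hec i j).1
  have hsa : ∀ i j, segment ℝ (x i) (p i j) ⊆ a i := fun i j =>
    (hac i).segment_subset (interior_subset (hx i)) (hp i j).1
  have hsu : ∀ i j, segment ℝ (p i j) (y j) ⊆ u j := fun i j =>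
    (huc j).segment_subset (hp i j).2 (interior_subset (hy j))
  have hmixed : ∀ i j k l, i ≠ k →
      Disjoint (segment ℝ (x i) (p i j)) (segment ℝ (p k l) (y l)) := by
    intro i j k l hik
    rw [Set.disjoint_left]
    intro z hza hzu
    have hzi : z ∉ interior (a i) := fun hz =>
      ((hur l).disjoint_interior_left (hec i l)).ne_of_mem hz (hsu k l hzu) rfl
    have hzl : z ∉ interior (u l) := fun hz =>
      ((har i).disjoint_interior_left (hec i l).symm).ne_of_mem hz (hsa i j hza) rfl
    have e₁ := (hac i).eq_right_of_mem_segment_of_notMem_interior (hx i) (hp i j).1 hza hzi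
    have e₂ := (huc l).eq_right_of_mem_segment_of_notMem_interior (hy l) (hp k l).2
      (segment_symm ℝ (p k l) (y l) ▸ hzu) hzl
    exact (had hik).ne_of_mem (hp i j).1 (hp k l).1 (e₁.symm.trans e₂)
  obtain ⟨φ⟩ : Nonempty (EuclideanSpace ℝ (Fin 2) ≃ₗ[ℝ] ℂ) :=
    ⟨Complex.orthonormalBasisOneI.repr.symm.toLinearEquiv⟩
  have hφ : ∀ s t, segment ℝ (φ s) (φ t) = φ '' segment ℝ s t := fun s t =>
    (image_segment ℝ φ.toLinearMap.toAffineMap s t).symm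
  refine false_of_disjoint_two_segment_paths (φ ∘ x) (φ ∘ y) (fun i j => φ (p i j)) ?_
  intro i j k l hik hjl
  simp only [Function.comp_apply, hφ, ← Set.image_union]
  rw [Set.disjoint_image_iff φ.injective]
  simp only [Set.disjoint_union_left, Set.disjoint_union_right]
  exact ⟨⟨(had hik).mono (hsa i j) (hsa k l), (hmixed k l i j hik.symm).symm⟩,
    hmixed i j k l hik, (hud hjl).mono (hsu i j) (hsu k l)⟩

/-- There is a consistent atomic RCC8 network over {EC, DC} with no convex
solution in ℝ². -/
theorem statement11 :
    (∃ a b c u v w : Set (EuclideanSpace ℝ (Fin 3)),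
      a.Nonempty ∧ b.Nonempty ∧ c.Nonempty ∧ u.Nonempty ∧ v.Nonempty ∧ w.Nonempty ∧
      RegClosed a ∧ RegClosed b ∧ RegClosed c ∧
      RegClosed u ∧ RegClosed v ∧ RegClosed w ∧
      EC a u ∧ EC a v ∧ EC a w ∧ EC b u ∧ EC b v ∧ EC b w ∧
      EC c u ∧ EC c v ∧ EC c w ∧
      DC a b ∧ DC a c ∧ DC b c ∧ DC u v ∧ DC u w ∧ DC v w) ∧
    ¬ (∃ a b c u v w : Set (EuclideanSpace ℝ (Fin 2)),
      a.Nonempty ∧ b.Nonempty ∧ c.Nonempty ∧ u.Nonempty ∧ v.Nonempty ∧ w.Nonempty ∧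
      Convex ℝ a ∧ Convex ℝ b ∧ Convex ℝ c ∧
      Convex ℝ u ∧ Convex ℝ v ∧ Convex ℝ w ∧
      RegClosed a ∧ RegClosed b ∧ RegClosed c ∧
      RegClosed u ∧ RegClosed v ∧ RegClosed w ∧
      EC a u ∧ EC a v ∧ EC a w ∧ EC b u ∧ EC b v ∧ EC b w ∧
      EC c u ∧ EC c v ∧ EC c w ∧
      DC a b ∧ DC a c ∧ DC b c ∧ DC u v ∧ DC u w ∧ DC v w) := by
  constructor
  · refine ⟨halfSlab 0 0 (-1), halfSlab 0 2 (-1), halfSlab 0 4 (-1),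
      halfSlab 1 0 1, halfSlab 1 2 1, halfSlab 1 4 1, ?_⟩
    refine ⟨?_, ?_, ?_, ?_, ?_, ?_, ?_, ?_, ?_, ?_, ?_, ?_, ec_halfSlab _ _, ec_halfSlab _ _,
      ec_halfSlab _ _, ec_halfSlab _ _, ec_halfSlab _ _, ec_halfSlab _ _, ec_halfSlab _ _,
      ec_halfSlab _ _, ec_halfSlab _ _, ?_, ?_, ?_, ?_, ?_, ?_⟩
    all_goals first
      | exact halfSlab_nonempty (by decide) _ (by norm_num)
      | exact regClosed_halfSlab (by decide) _ (by norm_num)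
      | exact dc_halfSlab _ (by norm_num) _
  · rintro ⟨a, b, c, u, v, w, ha, hb, hc, hu, hv, hw, ca, cb, cc, cu, cv, cw, ra, rb, rc, ru, rv,
      rw', au, av, aw, bu, bv, bw, cu', cv', cw', ab, ac, bc, uv, uw, vw⟩
    rw [DC, ← Set.disjoint_iff_inter_eq_empty] at ab ac bc uv uw vw
    refine false_of_convex_regClosed_contacts ![a, b, c] ![u, v, w] ?_ ?_ ?_ ?_ ?_ ?_ ?_ ?_ ?_
    · simp [Fin.forall_fin_succ, *]
    · simp [Fin.forall_fin_succ, *]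
    · simp [Fin.forall_fin_succ, *]
    · simp [Fin.forall_fin_succ, *]
    · simp [Fin.forall_fin_succ, *]
    · simp [Fin.forall_fin_succ, *]
    · simp [Fin.forall_fin_succ, *]
    · intro i k hik
      fin_cases i <;> fin_cases k <;> simp_all [disjoint_comm]
    · intro i k hik
      fin_cases i <;> fin_cases k <;> simp_all [disjoint_comm]
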